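/- Let ℓ ≥ 1 and N > 2ℓ+2, with periodic boundary conditions or special boundary conditions s = (c₁, c_N). Then for every f, the cohomology H_Q^f of the full supercharge Q = Q₁ + Q₂ is isomorphic to the graded piece H₂₁^f of the two-step cohomology; in particular dim H_Q^f = dim H₂₁^f. -/

import Mathlib

attribute [local instance 10] Classical.propDecidable

noncomputable section

/-- A configuration of `N` sites: `true` = occupied, `false` = empty. -/
abbrev Config (N : ℕ) := Fin N → Bool

/-- Extension of a configuration to all of `ℕ`, by empty sites outside the chain. -/
def extc {N : ℕ} (σ : Config N) (t : ℕ) : Bool :=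
  if h : t < N then σ ⟨t, h⟩ else false

/-- The fermion number: the number of occupied sites. -/
def fermions {N : ℕ} (σ : Config N) : ℕ :=
  (Finset.univ.filter fun i => σ i = true).card

/-- Allowed configurations of the open chain of `N` sites with exclusion parameter `ℓ`
and special boundary conditions `(c₁, cN)`: no cluster is longer than `ℓ`, the cluster
containing the first site (if occupied) has length at most `c₁`, and the cluster
containing the last site (if occupied) has length at most `cN`. -/
def OpenOK (N ℓ c₁ cN : ℕ) (σ : Config N) : Prop :=
  (∀ a : ℕ, ¬ ∀ k ≤ ℓ, extc σ (a + k) = true) ∧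
  (¬ (c₁ + 1 ≤ N ∧ ∀ k ≤ c₁, extc σ k = true)) ∧
  (¬ (cN + 1 ≤ N ∧ ∀ k ≤ cN, extc σ (N - 1 - k) = true))

/-- Cyclic shift of a site of the closed chain by `k` steps. -/
def cyc {N : ℕ} (i : Fin N) (k : ℕ) : Fin N :=
  ⟨(i.1 + k) % N, Nat.mod_lt _ i.pos⟩

/-- Allowed configurations of the closed chain of `N` sites with periodic boundary
conditions: the chain is not fully occupied and no maximal cyclic run of occupied
sites is longer than `ℓ`. -/
def PerOK (N ℓ : ℕ) (σ : Config N) : Prop :=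
  ∀ i : Fin N, ∃ k ≤ ℓ, σ (cyc i k) = false

/-- The fermionic sign `(-1)^{#{j < i : σ j = 1}}`. -/
def sgn {N : ℕ} (σ : Config N) (i : Fin N) : ℂ :=
  (-1 : ℂ) ^ ((Finset.univ.filter fun j => j < i ∧ σ j = true).card)

/-- The Hilbert space `V_N`: complex functions on allowed configurations. -/
abbrev AState (N : ℕ) (OK : Config N → Prop) := {σ : Config N // OK σ} → ℂ

/-- Matrix of the supercharge with amplitudes `A`, with particle insertion
restricted to the sublattice `S`: the entry `(τ, σ)` is the amplitude (with fermionic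
sign) for obtaining `τ` from `σ` by occupying an empty site of `S`. -/
def QmatA (N : ℕ) (OK : Config N → Prop) (S : Fin N → Prop)
    (A : Config N → Fin N → ℂ) :
    Matrix {σ : Config N // OK σ} {σ : Config N // OK σ} ℂ := fun τ σ =>
  ∑ i : Fin N,
    if S i ∧ σ.1 i = false ∧ τ.1 = Function.update σ.1 i true
    then A σ.1 i * sgn σ.1 i else 0

/-- The supercharge with amplitudes `A` restricted to the sublattice `S`, as a linear map. -/
def QopA (N : ℕ) (OK : Config N → Prop) (S : Fin N → Prop)
    (A : Config N → Fin N → ℂ) : AState N OK →ₗ[ℂ] AState N OK :=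
  (QmatA N OK S A).mulVecLin

/-- The unit-coupling supercharge restricted to the sublattice `S`. -/
def Qop (N : ℕ) (OK : Config N → Prop) (S : Fin N → Prop) :
    AState N OK →ₗ[ℂ] AState N OK :=
  QopA N OK S fun _ _ => 1

/-- The subspace `V_{N,f}` of states supported on configurations with fermion number `f`. -/
def gradeV (N : ℕ) (OK : Config N → Prop) (f : ℕ) :
    Submodule ℂ (AState N OK) where
  carrier := {ψ | ∀ σ, fermions σ.1 ≠ f → ψ σ = 0}
  add_mem' := by
    intro a b ha hb σ h
    show a σ + b σ = 0
    rw [ha σ h, hb σ h, add_zero]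
  zero_mem' := by intro σ h; rfl
  smul_mem' := by
    intro c a ha σ h
    show c * a σ = 0
    rw [ha σ h, mul_zero]

/-- The cocycles at gradeV `f`: `ker Q ∩ V_{N,f}` (for the supercharge restricted to `S`). -/
def cocycles (N : ℕ) (OK : Config N → Prop) (S : Fin N → Prop) (f : ℕ) :
    Submodule ℂ (AState N OK) :=
  LinearMap.ker (Qop N OK S) ⊓ gradeV N OK f

/-- The coboundaries at gradeV `f`: `Q (V_{N,f-1})` (for the supercharge restricted to `S`). -/
def cobounds (N : ℕ) (OK : Config N → Prop) (S : Fin N → Prop) (f : ℕ) :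
    Submodule ℂ (AState N OK) :=
  (gradeV N OK (f - 1)).map (Qop N OK S)

/-- The cohomology `H_Q^f = ker (Q : V_{N,f} → V_{N,f+1}) / Q (V_{N,f-1})`. -/
abbrev CohSpace (N : ℕ) (OK : Config N → Prop) (S : Fin N → Prop) (f : ℕ) :=
  cocycles N OK S f ⧸ ((cobounds N OK S f).comap (cocycles N OK S f).subtype)

/-- The dimension of `H_Q^f`. -/
def cohDim (N : ℕ) (OK : Config N → Prop) (S : Fin N → Prop) (f : ℕ) : ℕ :=
  Module.finrank ℂ (CohSpace N OK S f)

/-- The cohomology class represented by a cocycle. -/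
def cohClass (N : ℕ) (OK : Config N → Prop) (S : Fin N → Prop) (f : ℕ)
    (ψ : AState N OK) (h : ψ ∈ cocycles N OK S f) : CohSpace N OK S f :=
  Submodule.Quotient.mk ⟨ψ, h⟩

/-- The first sublattice `S₁ = {1, …, ℓ+2}` (the first `ℓ+2` sites). -/
def S1 (N ℓ : ℕ) : Fin N → Prop := fun i => i.1 < ℓ + 2

/-- The second sublattice `S₂ = {ℓ+3, …, N}` (the remaining sites). -/
def S2 (N ℓ : ℕ) : Fin N → Prop := fun i => ℓ + 2 ≤ i.1

/-- The configuration `χ σ'`: the `(ℓ+2)`-site configuration `χ = 0 1…1 0`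
followed by the `Ñ`-site configuration `σ'`. -/
def glue (ℓ Nt : ℕ) (σ : Config Nt) : Config (Nt + (ℓ + 2)) := fun i =>
  if h : i.1 < ℓ + 2 then decide (1 ≤ i.1 ∧ i.1 ≤ ℓ)
  else σ ⟨i.1 - (ℓ + 2), by have h2 := i.isLt; omega⟩

/-- Matrix of the map `G : V_Ñ → V_N`, `e_{σ'} ↦ e_{χ σ'}`. -/
def Gmat (ℓ Nt : ℕ) (OKN : Config (Nt + (ℓ + 2)) → Prop) (OKt : Config Nt → Prop) :
    Matrix {σ : Config (Nt + (ℓ + 2)) // OKN σ} {σ : Config Nt // OKt σ} ℂ :=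
  fun τ σ => if τ.1 = glue ℓ Nt σ.1 then 1 else 0

/-- The linear map `G : V_Ñ → V_N` sending `e_{σ'}` to `e_{χ σ'}`. -/
def Gop (ℓ Nt : ℕ) (OKN : Config (Nt + (ℓ + 2)) → Prop) (OKt : Config Nt → Prop) :
    AState Nt OKt →ₗ[ℂ] AState (Nt + (ℓ + 2)) OKN :=
  (Gmat ℓ Nt OKN OKt).mulVecLin

/-- Cocycles of the two-step complex at gradeV `f`: states `ψ ∈ V_{N,f}` with
`Q₁ ψ = 0` and `Q₂ ψ ∈ im Q₁`. -/
def K21 (N : ℕ) (OK : Config N → Prop) (ℓ f : ℕ) : Submodule ℂ (AState N OK) :=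
  LinearMap.ker (Qop N OK (S1 N ℓ)) ⊓ gradeV N OK f ⊓
    (LinearMap.range (Qop N OK (S1 N ℓ))).comap (Qop N OK (S2 N ℓ))

/-- Coboundaries of the two-step complex at gradeV `f`: states of the form
`Q₂ α + Q₁ β` with `Q₁ α = 0`, of fermion number `f`. -/
def B21 (N : ℕ) (OK : Config N → Prop) (ℓ f : ℕ) : Submodule ℂ (AState N OK) :=
  ((LinearMap.ker (Qop N OK (S1 N ℓ))).map (Qop N OK (S2 N ℓ)) ⊔
      LinearMap.range (Qop N OK (S1 N ℓ))) ⊓ gradeV N OK f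

/-- The two-step cohomology `H₂₁ = H_{Q₂}(H_{Q₁})` at gradeV `f`. -/
abbrev H21 (N : ℕ) (OK : Config N → Prop) (ℓ f : ℕ) :=
  K21 N OK ℓ f ⧸ ((B21 N OK ℓ f).comap (K21 N OK ℓ f).subtype)

/-- The class in the two-step cohomology represented by a cocycle. -/
def h21Class (N : ℕ) (OK : Config N → Prop) (ℓ f : ℕ)
    (ψ : AState N OK) (h : ψ ∈ K21 N OK ℓ f) : H21 N OK ℓ f :=
  Submodule.Quotient.mk ⟨ψ, h⟩

/-- A family of configurations is closed under removing particles. -/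
def DownClosed {N : ℕ} (OK : Config N → Prop) : Prop :=
  ∀ σ i, OK σ → OK (Function.update σ i false)

/-- The number of occupied sites in the sublattice `S`. -/
def countOn {N : ℕ} (S : Fin N → Prop) (σ : Config N) : ℕ :=
  (Finset.univ.filter fun i => S i ∧ σ i = true).card

/-- Restriction of a state to the configurations satisfying `p`. -/
def proj (N : ℕ) (OK : Config N → Prop) (p : Config N → Prop) :
    AState N OK →ₗ[ℂ] AState N OK where
  toFun ψ σ := if p σ.1 then ψ σ else 0
  map_add' a b := by
    funext σ
    by_cases h : p σ.1 <;> simp [h]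
  map_smul' c a := by
    funext σ
    by_cases h : p σ.1 <;> simp [h]

section Supercharge

variable {N : ℕ} {OK : Config N → Prop}

lemma proj_apply (p : Config N → Prop) (ψ : AState N OK) (σ : {σ : Config N // OK σ}) :
    proj N OK p ψ σ = if p σ.1 then ψ σ else 0 := rfl

lemma sgn_mul_self (σ : Config N) (i : Fin N) : sgn σ i * sgn σ i = 1 := by
  unfold sgn
  rw [← mul_pow]
  simp

lemma sgn_ne_zero (σ : Config N) (i : Fin N) : sgn σ i ≠ 0 :=
  left_ne_zero_of_mul_eq_one (sgn_mul_self σ i)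

lemma sgn_update_of_le (σ : Config N) {i j : Fin N} (h : j ≤ i) (b : Bool) :
    sgn (Function.update σ i b) j = sgn σ j := by
  unfold sgn
  congr 2
  ext k
  simp only [Finset.mem_filter, Finset.mem_univ, true_and]
  refine and_congr_right fun hk => ?_
  rw [Function.update_of_ne (ne_of_lt (lt_of_lt_of_le hk h))]

lemma sgn_update_of_lt (σ : Config N) {i j : Fin N} (h : i < j) (hi : σ i = true) :
    sgn (Function.update σ i false) j = - sgn σ j := by
  unfold sgn
  have : (Finset.univ.filter fun k => k < j ∧ σ k = true) =
      insert i (Finset.univ.filter fun k => k < j ∧ Function.update σ i false k = true) := by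
    ext k
    by_cases hk : k = i
    · subst hk
      simp [h, hi]
    · simp [hk]
  rw [this, Finset.card_insert_of_notMem (by simp), pow_succ]
  ring

lemma countOn_update_of_mem {S : Fin N → Prop} {σ : Config N} {i : Fin N} (hS : S i)
    (hi : σ i = true) : countOn S (Function.update σ i false) + 1 = countOn S σ := by
  unfold countOn
  have : (Finset.univ.filter fun k => S k ∧ σ k = true) =
      insert i (Finset.univ.filter fun k => S k ∧ Function.update σ i false k = true) := by
    ext k
    by_cases hk : k = i
    · subst hk
      simp [hS, hi]
    · simp [hk]
  rw [this, Finset.card_insert_of_notMem (by simp)]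

lemma countOn_update_of_not_mem {S : Fin N → Prop} {σ : Config N} {i : Fin N} (hS : ¬ S i)
    (b : Bool) : countOn S (Function.update σ i b) = countOn S σ := by
  unfold countOn
  congr 1
  ext k
  by_cases hk : k = i
  · subst hk
    simp [hS]
  · simp [Function.update_of_ne hk]

lemma fermions_eq_countOn (σ : Config N) : fermions σ = countOn (fun _ => True) σ := by
  simp [fermions, countOn]

/-- Removal of the particle at `i` from an allowed configuration. -/
def removeAt (hd : DownClosed OK) (τ : {σ : Config N // OK σ}) (i : Fin N) :
    {σ : Config N // OK σ} :=
  ⟨Function.update τ.1 i false, hd _ _ τ.2⟩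

lemma Qop_apply (hd : DownClosed OK) (S : Fin N → Prop) (ψ : AState N OK)
    (τ : {σ : Config N // OK σ}) :
    Qop N OK S ψ τ =
      ∑ i, if S i ∧ τ.1 i = true then sgn τ.1 i * ψ (removeAt hd τ i) else 0 := by
  simp only [Qop, QopA, QmatA, Matrix.mulVecLin_apply, Matrix.mulVec, dotProduct,
    Finset.sum_mul, one_mul]
  rw [Finset.sum_comm]
  refine Finset.sum_congr rfl fun i _ => ?_
  rw [Finset.sum_eq_single (removeAt hd τ i)]
  · have hsg : sgn (removeAt hd τ i).1 i = sgn τ.1 i := sgn_update_of_le _ le_rfl _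
    by_cases h : τ.1 i = true
    · have : τ.1 = Function.update (removeAt hd τ i).1 i true := by
        simp [removeAt, ← h]
      by_cases hS : S i
      · rw [if_pos ⟨hS, by simp [removeAt], this⟩, if_pos ⟨hS, h⟩, hsg]
      · simp [hS]
    · have : ¬ τ.1 = Function.update (removeAt hd τ i).1 i true := by
        intro h2
        apply h
        rw [h2]
        simp
      simp [h, this]
  · intro σ _ hσ
    rw [if_neg, zero_mul]
    rintro ⟨-, h1, h2⟩
    apply hσ
    apply Subtype.ext
    simp [removeAt, h2, ← h1]
  · simp

lemma Qop_Qop (hd : DownClosed OK) (S : Fin N → Prop) (ψ : AState N OK) :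
    Qop N OK S (Qop N OK S ψ) = 0 := by
  funext τ
  rw [Qop_apply hd]
  simp only [Qop_apply hd S ψ]
  set F : Fin N → Fin N → ℂ := fun i j => if S i ∧ τ.1 i = true then
    sgn τ.1 i * (if S j ∧ (removeAt hd τ i).1 j = true then
      sgn (removeAt hd τ i).1 j * ψ (removeAt hd (removeAt hd τ i) j) else 0) else 0 with hF
  have key : ∀ i j, i < j → F i j = - F j i := by
    intro i j hij
    have h1 : (removeAt hd τ i).1 j = τ.1 j := Function.update_of_ne hij.ne' _ _
    have h2 : (removeAt hd τ j).1 i = τ.1 i := Function.update_of_ne hij.ne _ _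
    have h3 : removeAt hd (removeAt hd τ i) j = removeAt hd (removeAt hd τ j) i :=
      Subtype.ext (Function.update_comm hij.ne _ _ _)
    have h5 : sgn (removeAt hd τ j).1 i = sgn τ.1 i := sgn_update_of_le _ hij.le _
    simp only [hF, h1, h2, h3, h5]
    by_cases hi : S i ∧ τ.1 i = true
    · have h4 : sgn (removeAt hd τ i).1 j = - sgn τ.1 j := sgn_update_of_lt _ hij hi.2
      rw [h4]
      by_cases hj : S j ∧ τ.1 j = true
      · simp only [hi, hj]
        simp
        ring
      · simp [hj]
    · simp [hi]
  have anti : ∀ i j, F i j = - F j i := by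
    intro i j
    rcases lt_trichotomy i j with h | h | h
    · exact key i j h
    · subst h
      simp [hF, removeAt]
    · rw [key j i h, neg_neg]
  have hsum : ∑ i, ∑ j, F i j = - ∑ i, ∑ j, F i j := by
    conv_lhs => rw [Finset.sum_comm]
    rw [← Finset.sum_neg_distrib]
    refine Finset.sum_congr rfl fun i _ => ?_
    rw [← Finset.sum_neg_distrib]
    exact Finset.sum_congr rfl fun j _ => anti j i
  have h0 : ∑ i, ∑ j, F i j = 0 := self_eq_neg.mp hsum
  refine Eq.trans ?_ h0
  refine Finset.sum_congr rfl fun i _ => ?_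
  simp only [hF]
  by_cases hi : S i ∧ τ.1 i = true
  · simp only [if_pos hi, Finset.mul_sum]
  · simp only [if_neg hi, Finset.sum_const_zero]

lemma proj_Qop (hd : DownClosed OK) {S : Fin N → Prop} {p q : Config N → Prop}
    (h : ∀ τ i, S i → τ i = true → (q τ ↔ p (Function.update τ i false)))
    (ψ : AState N OK) :
    proj N OK q (Qop N OK S ψ) = Qop N OK S (proj N OK p ψ) := by
  funext τ
  rw [proj_apply, Qop_apply hd, Qop_apply hd]
  by_cases hq : q τ.1
  · rw [if_pos hq]
    refine Finset.sum_congr rfl fun i _ => ?_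
    by_cases hi : S i ∧ τ.1 i = true
    · rw [if_pos hi, if_pos hi, proj_apply, if_pos]
      exact (h _ _ hi.1 hi.2).1 hq
    · rw [if_neg hi, if_neg hi]
  · rw [if_neg hq, Finset.sum_eq_zero]
    intro i _
    by_cases hi : S i ∧ τ.1 i = true
    · rw [if_pos hi, proj_apply, if_neg, mul_zero]
      exact fun hp => hq ((h _ _ hi.1 hi.2).2 hp)
    · rw [if_neg hi]

lemma Qop_add_Qop_not (hd : DownClosed OK) {S T : Fin N → Prop} (h : ∀ i, T i ↔ ¬ S i)
    (ψ : AState N OK) :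
    Qop N OK (fun _ => True) ψ = Qop N OK S ψ + Qop N OK T ψ := by
  funext τ
  rw [Pi.add_apply, Qop_apply hd, Qop_apply hd, Qop_apply hd, ← Finset.sum_add_distrib]
  refine Finset.sum_congr rfl fun i _ => ?_
  by_cases hi : S i <;> simp [h, hi]

/-- Removal of a particle from the site `x`, as an operator on states. -/
def removal (OK : Config N → Prop) (x : Fin N) (ψ : AState N OK) : AState N OK := fun σ =>
  if h : σ.1 x = false ∧ OK (Function.update σ.1 x true) then sgn σ.1 x * ψ ⟨_, h.2⟩ else 0

lemma Qop_removal (hd : DownClosed OK) {S : Fin N → Prop} {x : Fin N} (hx : S x)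
    (ψ : AState N OK) (τ : {σ : Config N // OK σ}) (hτ : τ.1 x = true) :
    Qop N OK S (removal OK x ψ) τ = ψ τ := by
  rw [Qop_apply hd, Finset.sum_eq_single x]
  · have h1 : (removeAt hd τ x).1 x = false := by simp [removeAt]
    have h2 : Function.update (removeAt hd τ x).1 x true = τ.1 := by simp [removeAt, ← hτ]
    have h3 : sgn (removeAt hd τ x).1 x = sgn τ.1 x := sgn_update_of_le _ le_rfl _
    rw [if_pos ⟨hx, hτ⟩, removal, dif_pos ⟨h1, h2 ▸ τ.2⟩, ← mul_assoc, h3, sgn_mul_self, one_mul]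
    congr 1
    exact Subtype.ext h2
  · intro i _ hi
    split_ifs with h
    · rw [removal, dif_neg, mul_zero]
      rintro ⟨h1, -⟩
      simp [removeAt, Function.update_of_ne hi.symm, hτ] at h1
    · rfl
  · simp

/-- A cocycle can be changed by a coboundary so that it is supported on configurations to
which no particle can be added at `x`. -/
lemma sub_Qop_removal_eq_zero (hd : DownClosed OK) {S : Fin N → Prop} {x : Fin N} (hx : S x)
    {ψ : AState N OK} (hψ : Qop N OK S ψ = 0) (σ : {σ : Config N // OK σ})
    (hσ : OK (Function.update σ.1 x true)) :
    (ψ - Qop N OK S (removal OK x ψ)) σ = 0 := by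
  set χ := ψ - Qop N OK S (removal OK x ψ) with hχ
  have h0 : ∀ τ : {σ : Config N // OK σ}, τ.1 x = true → χ τ = 0 := by
    intro τ hτ
    rw [hχ, Pi.sub_apply, Qop_removal hd hx ψ τ hτ, sub_self]
  by_cases hσx : σ.1 x = true
  · exact h0 σ hσx
  have hQ : Qop N OK S χ = 0 := by rw [hχ, map_sub, hψ, Qop_Qop hd, sub_zero]
  have h1 := congrFun hQ ⟨_, hσ⟩
  rw [Qop_apply hd, Finset.sum_eq_single x] at h1
  · rw [if_pos ⟨hx, by simp⟩, Pi.zero_apply] at h1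
    have h2 := (mul_eq_zero.mp h1).resolve_left (sgn_ne_zero _ _)
    have h3 : removeAt hd ⟨_, hσ⟩ x = σ := by
      apply Subtype.ext
      simp only [removeAt, Function.update_idem]
      rw [Bool.not_eq_true] at hσx
      rw [← hσx, Function.update_eq_self]
    rwa [h3] at h2
  · intro i _ hi
    split_ifs with h
    · rw [h0, mul_zero]
      simp [removeAt, Function.update_of_ne hi.symm]
    · rfl
  · simp

/-- A cocycle can be changed by a coboundary so that it is supported on configurations to
which no particle can be added at `x` nor at `y`. -/
lemma exists_sub_Qop_eq_zero (hd : DownClosed OK) {S : Fin N → Prop} {x y : Fin N} (hx : S x)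
    (hy : S y)
    (hxy : ∀ σ, OK (Function.update σ x true) → OK (Function.update σ y true) →
      OK (Function.update (Function.update σ y true) x true))
    {ψ : AState N OK} (hψ : Qop N OK S ψ = 0) :
    ∃ φ, ∀ σ : {σ : Config N // OK σ},
      OK (Function.update σ.1 x true) ∨ OK (Function.update σ.1 y true) →
      (ψ - Qop N OK S φ) σ = 0 := by
  set χ := ψ - Qop N OK S (removal OK x ψ) with hχ
  have hχ0 : ∀ σ : {σ : Config N // OK σ}, OK (Function.update σ.1 x true) → χ σ = 0 :=
    sub_Qop_removal_eq_zero hd hx hψ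
  have hQ : Qop N OK S χ = 0 := by rw [hχ, map_sub, hψ, Qop_Qop hd, sub_zero]
  refine ⟨removal OK x ψ + removal OK y χ, fun σ h => ?_⟩
  have he : ψ - Qop N OK S (removal OK x ψ + removal OK y χ) =
      χ - Qop N OK S (removal OK y χ) := by
    rw [map_add, hχ]
    abel
  rw [he]
  rcases h with h | h
  · rw [Pi.sub_apply, hχ0 σ h, Qop_apply hd, Finset.sum_eq_zero, sub_zero]
    intro i _
    split_ifs with hi
    · rw [removal]
      split_ifs with hr
      · rw [hχ0, mul_zero, mul_zero]
        refine hxy _ ?_ hr.2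
        by_cases hix : x = i
        · subst hix
          have : Function.update (removeAt hd σ x).1 x true = σ.1 := by
            simp [removeAt, ← hi.2]
          rw [this]
          exact σ.2
        · simp only [removeAt]
          rw [Function.update_comm (Ne.symm hix)]
          exact hd _ _ h
      · rw [mul_zero]
    · rfl
  · exact sub_Qop_removal_eq_zero hd hy hQ σ h

end Supercharge

section TwoStep

variable {N ℓ : ℕ} {OK : Config N → Prop}

lemma proj_eq_self {p : Config N → Prop} {ψ : AState N OK} (h : ∀ σ, ¬ p σ.1 → ψ σ = 0) :
    proj N OK p ψ = ψ := by
  funext σ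
  by_cases hp : p σ.1
  · simp [proj_apply, hp]
  · simp [proj_apply, hp, h σ hp]

lemma proj_eq_zero {p : Config N → Prop} {ψ : AState N OK} (h : ∀ σ, p σ.1 → ψ σ = 0) :
    proj N OK p ψ = 0 := by
  funext σ
  by_cases hp : p σ.1
  · simp [proj_apply, hp, h σ hp]
  · simp [proj_apply, hp]

lemma Qop_True_eq (hd : DownClosed OK) (ψ : AState N OK) :
    Qop N OK (fun _ => True) ψ = Qop N OK (S1 N ℓ) ψ + Qop N OK (S2 N ℓ) ψ :=
  Qop_add_Qop_not hd (fun i => by simp [S1, S2]) ψ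

lemma proj_Qop_S1 (hd : DownClosed OK) (p : ℕ → Prop) (ψ : AState N OK) :
    proj N OK (fun σ => p (countOn (S1 N ℓ) σ)) (Qop N OK (S1 N ℓ) ψ) =
      Qop N OK (S1 N ℓ) (proj N OK (fun σ => p (countOn (S1 N ℓ) σ + 1)) ψ) :=
  proj_Qop hd (fun τ i hi h => by rw [countOn_update_of_mem hi h]) ψ

lemma proj_Qop_S2 (hd : DownClosed OK) (p : ℕ → Prop) (ψ : AState N OK) :
    proj N OK (fun σ => p (countOn (S1 N ℓ) σ)) (Qop N OK (S2 N ℓ) ψ) =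
      Qop N OK (S2 N ℓ) (proj N OK (fun σ => p (countOn (S1 N ℓ) σ)) ψ) :=
  proj_Qop hd (fun τ i hi h => by
    rw [countOn_update_of_not_mem (show ¬ S1 N ℓ i from not_lt.2 hi)]) ψ

lemma proj_Qop_fermions (hd : DownClosed OK) (S : Fin N → Prop) (f : ℕ) (ψ : AState N OK) :
    proj N OK (fun σ => fermions σ = f) (Qop N OK S ψ) =
      Qop N OK S (proj N OK (fun σ => fermions σ + 1 = f) ψ) :=
  proj_Qop hd (fun τ i _ h => by
    rw [fermions_eq_countOn, fermions_eq_countOn, countOn_update_of_mem trivial h]) ψ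

lemma Qop_S2_eq_zero (hd : DownClosed OK) {k : ℕ} {φ : AState N OK}
    (h : ∀ σ, k ≤ countOn (S1 N ℓ) σ.1 → φ σ = 0) (σ : {σ : Config N // OK σ})
    (hσ : k ≤ countOn (S1 N ℓ) σ.1) : Qop N OK (S2 N ℓ) φ σ = 0 := by
  rw [Qop_apply hd, Finset.sum_eq_zero]
  intro i _
  split_ifs with hi
  · rw [h, mul_zero]
    rwa [removeAt, countOn_update_of_not_mem (show ¬ S1 N ℓ i from not_lt.2 hi.1)]
  · rfl

/-- The cohomology of the supercharge on the first sublattice is concentrated on the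
configurations with exactly `ℓ` particles on that sublattice. -/
def Concentrated (N ℓ : ℕ) (OK : Config N → Prop) : Prop :=
  ∀ ψ : AState N OK, Qop N OK (S1 N ℓ) ψ = 0 →
    (∀ σ, countOn (S1 N ℓ) σ.1 = ℓ → ψ σ = 0) → ∃ φ, Qop N OK (S1 N ℓ) φ = ψ

lemma exists_lower_top (hd : DownClosed OK) (hex : Concentrated N ℓ OK) {j : ℕ} (hj : j ≠ ℓ)
    {ψ : AState N OK} (h1 : ∀ σ, j + 1 ≤ countOn (S1 N ℓ) σ.1 → ψ σ = 0)
    (h2 : ∀ σ, j + 1 ≤ countOn (S1 N ℓ) σ.1 → Qop N OK (fun _ => True) ψ σ = 0) :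
    ∃ φ, (∀ σ, j ≤ countOn (S1 N ℓ) σ.1 → φ σ = 0) ∧
      ∀ σ, j ≤ countOn (S1 N ℓ) σ.1 → (ψ - Qop N OK (fun _ => True) φ) σ = 0 := by
  set χ := proj N OK (fun σ => countOn (S1 N ℓ) σ = j) ψ with hχ
  have hc : Qop N OK (S1 N ℓ) χ = 0 := by
    have hp := proj_Qop_S1 (ℓ := ℓ) hd (fun n => n = j + 1) ψ
    simp only [Nat.add_right_cancel_iff] at hp
    rw [hχ, ← hp]
    refine proj_eq_zero fun σ hσ => ?_
    have h3 := h2 σ hσ.ge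
    rwa [Qop_True_eq (ℓ := ℓ) hd, Pi.add_apply, Qop_S2_eq_zero hd h1 σ hσ.ge, add_zero] at h3
  obtain ⟨φ, hφ⟩ := hex χ hc fun σ hσ => by
    rw [hχ, proj_apply, if_neg (by omega)]
  refine ⟨proj N OK (fun σ => countOn (S1 N ℓ) σ + 1 = j) φ, ?_, ?_⟩
  · intro σ hσ
    rw [proj_apply, if_neg (by omega)]
  · intro σ hσ
    rw [Qop_True_eq (ℓ := ℓ) hd, ← proj_Qop_S1 (ℓ := ℓ) hd (fun n => n = j), hφ, Pi.sub_apply,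
      Pi.add_apply, Qop_S2_eq_zero (k := j) hd _ σ hσ, add_zero, proj_apply, hχ, proj_apply]
    · by_cases h : countOn (S1 N ℓ) σ.1 = j
      · simp [h]
      · rw [h1 σ (by omega)]
        simp
    · intro τ hτ
      rw [proj_apply, if_neg (by omega)]

lemma exists_sub_Qop_supported (hd : DownClosed OK) (hex : Concentrated N ℓ OK)
    {ψ : AState N OK}
    (h2 : ∀ σ, ℓ + 1 ≤ countOn (S1 N ℓ) σ.1 → Qop N OK (fun _ => True) ψ σ = 0) :
    ∃ γ, ∀ σ, ℓ + 1 ≤ countOn (S1 N ℓ) σ.1 → (ψ - Qop N OK (fun _ => True) γ) σ = 0 := by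
  have key : ∀ k, ∀ ψ : AState N OK,
      (∀ σ, ℓ + 1 + k ≤ countOn (S1 N ℓ) σ.1 → ψ σ = 0) →
      (∀ σ, ℓ + 1 ≤ countOn (S1 N ℓ) σ.1 → Qop N OK (fun _ => True) ψ σ = 0) →
      ∃ γ, ∀ σ, ℓ + 1 ≤ countOn (S1 N ℓ) σ.1 →
        (ψ - Qop N OK (fun _ => True) γ) σ = 0 := by
    intro k
    induction k with
    | zero =>
      intro ψ h1 _
      exact ⟨0, fun σ hσ => by rw [map_zero, sub_zero, h1 σ hσ]⟩
    | succ k ih =>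
      intro ψ h1 h2
      obtain ⟨φ, -, hφ⟩ := exists_lower_top (j := ℓ + 1 + k) hd hex (by omega) h1
        (fun σ hσ => h2 σ (by omega))
      obtain ⟨γ, hγ⟩ := ih (ψ - Qop N OK (fun _ => True) φ) hφ fun σ hσ => by
        rw [map_sub, Qop_Qop hd, sub_zero, h2 σ hσ]
      refine ⟨φ + γ, fun σ hσ => ?_⟩
      rw [map_add, ← sub_sub]
      exact hγ σ hσ
  refine key N ψ (fun σ hσ => ?_) h2
  have : countOn (S1 N ℓ) σ.1 ≤ N := by
    unfold countOn
    exact (Finset.card_le_univ _).trans (by simp)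
  omega

lemma exists_Qop_eq_of_supported (hd : DownClosed OK) (hex : Concentrated N ℓ OK) {k : ℕ}
    (hk : k ≤ ℓ) {ψ : AState N OK} (h1 : ∀ σ, k ≤ countOn (S1 N ℓ) σ.1 → ψ σ = 0)
    (h2 : Qop N OK (fun _ => True) ψ = 0) :
    ∃ φ, (∀ σ, k ≤ countOn (S1 N ℓ) σ.1 → φ σ = 0) ∧ Qop N OK (fun _ => True) φ = ψ := by
  induction k generalizing ψ with
  | zero =>
    refine ⟨0, fun _ _ => rfl, ?_⟩
    rw [map_zero]
    funext σ
    exact (h1 σ (Nat.zero_le _)).symm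
  | succ k ih =>
    obtain ⟨φ, hφ0, hφ⟩ := exists_lower_top (j := k) hd hex (by omega) h1
      (fun σ _ => by rw [h2]; rfl)
    obtain ⟨γ, hγ0, hγ⟩ := ih (by omega) hφ (by rw [map_sub, Qop_Qop hd, sub_zero, h2])
    refine ⟨φ + γ, fun σ hσ => ?_, ?_⟩
    · rw [Pi.add_apply, hφ0 σ (by omega), hγ0 σ (by omega), add_zero]
    · rw [map_add, hγ]
      abel

/-- Cocycles of the full supercharge with at most `ℓ` particles on the first sublattice. -/
def truncCocycles (N ℓ : ℕ) (OK : Config N → Prop) (f : ℕ) : Submodule ℂ (AState N OK) :=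
  cocycles N OK (fun _ => True) f ⊓
    LinearMap.ker (proj N OK fun σ => ℓ + 1 ≤ countOn (S1 N ℓ) σ)

lemma mem_truncCocycles {f : ℕ} {ψ : AState N OK} :
    ψ ∈ truncCocycles N ℓ OK f ↔ Qop N OK (fun _ => True) ψ = 0 ∧ ψ ∈ gradeV N OK f ∧
      ∀ σ, ℓ + 1 ≤ countOn (S1 N ℓ) σ.1 → ψ σ = 0 := by
  have : ψ ∈ LinearMap.ker (proj N OK fun σ => ℓ + 1 ≤ countOn (S1 N ℓ) σ) ↔
      ∀ σ, ℓ + 1 ≤ countOn (S1 N ℓ) σ.1 → ψ σ = 0 := by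
    rw [LinearMap.mem_ker]
    refine ⟨fun h σ hσ => ?_, fun h => proj_eq_zero h⟩
    have := congrFun h σ
    rwa [proj_apply, if_pos hσ] at this
  rw [truncCocycles, Submodule.mem_inf, this, cocycles, Submodule.mem_inf, LinearMap.mem_ker,
    and_assoc]

lemma proj_fermions_eq_self {f : ℕ} {ψ : AState N OK} (h : ψ ∈ gradeV N OK f) :
    proj N OK (fun σ => fermions σ = f) ψ = ψ :=
  proj_eq_self h

lemma proj_mem_gradeV {f : ℕ} (p : Config N → Prop) {ψ : AState N OK}
    (h : ψ ∈ gradeV N OK f) : proj N OK p ψ ∈ gradeV N OK f := by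
  intro σ hσ
  rw [proj_apply, h σ hσ, ite_self]

lemma proj_fermions_mem (f : ℕ) (ψ : AState N OK) :
    proj N OK (fun σ => fermions σ = f) ψ ∈ gradeV N OK f := by
  intro σ hσ
  rw [proj_apply, if_neg hσ]

lemma Qop_mem_cobounds (hd : DownClosed OK) {S : Fin N → Prop} {f : ℕ} {β : AState N OK}
    (h : Qop N OK S β ∈ gradeV N OK f) : Qop N OK S β ∈ cobounds N OK S f := by
  refine ⟨proj N OK (fun σ => fermions σ + 1 = f) β, ?_, ?_⟩
  · intro σ hσ
    rw [proj_apply, if_neg (by omega)]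
  · rw [← proj_Qop_fermions hd, proj_fermions_eq_self h]

lemma Qop_S1_proj_eq {f : ℕ} (hd : DownClosed OK) {ψ : AState N OK}
    (h : ψ ∈ truncCocycles N ℓ OK f) :
    Qop N OK (S1 N ℓ) (proj N OK (fun σ => countOn (S1 N ℓ) σ = ℓ) ψ) = 0 := by
  obtain ⟨hQ, -, hs⟩ := mem_truncCocycles.1 h
  have hp := proj_Qop_S1 (ℓ := ℓ) hd (fun n => n = ℓ + 1) ψ
  simp only [Nat.add_right_cancel_iff] at hp
  rw [← hp]
  refine proj_eq_zero fun σ hσ => ?_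
  have h3 := congrFun hQ σ
  rwa [Qop_True_eq (ℓ := ℓ) hd, Pi.add_apply, Qop_S2_eq_zero hd hs σ hσ.ge, add_zero] at h3

lemma proj_mem_K21 (hd : DownClosed OK) {f : ℕ} {ψ : AState N OK}
    (h : ψ ∈ truncCocycles N ℓ OK f) :
    proj N OK (fun σ => countOn (S1 N ℓ) σ = ℓ) ψ ∈ K21 N OK ℓ f := by
  obtain ⟨hQ, hg, hs⟩ := mem_truncCocycles.1 h
  refine ⟨⟨Qop_S1_proj_eq hd h, proj_mem_gradeV _ hg⟩,
    - proj N OK (fun σ => countOn (S1 N ℓ) σ + 1 = ℓ) ψ, ?_⟩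
  rw [map_neg, ← proj_Qop_S1 (ℓ := ℓ) hd (fun n => n = ℓ),
    ← proj_Qop_S2 (ℓ := ℓ) hd (fun n => n = ℓ), neg_eq_iff_add_eq_zero, ← map_add,
    ← Qop_True_eq hd, hQ, map_zero]

lemma exists_truncCocycle_sub_mem_cobounds (hd : DownClosed OK) (hex : Concentrated N ℓ OK)
    {f : ℕ} {ψ : AState N OK} (h : ψ ∈ cocycles N OK (fun _ => True) f) :
    ∃ χ ∈ truncCocycles N ℓ OK f, χ - ψ ∈ cobounds N OK (fun _ => True) f := by
  obtain ⟨hQ, hg⟩ := h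
  rw [SetLike.mem_coe, LinearMap.mem_ker] at hQ
  obtain ⟨γ, hγ⟩ := exists_sub_Qop_supported hd hex (ψ := ψ) fun σ _ => by rw [hQ]; rfl
  set γ' := proj N OK (fun σ => fermions σ + 1 = f) γ with hγ'
  have hq : ψ - Qop N OK (fun _ => True) γ' =
      proj N OK (fun σ => fermions σ = f) (ψ - Qop N OK (fun _ => True) γ) := by
    rw [map_sub, proj_Qop_fermions hd, proj_fermions_eq_self hg]
  have hqg : ψ - Qop N OK (fun _ => True) γ' ∈ gradeV N OK f := hq ▸ proj_fermions_mem f _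
  refine ⟨ψ - Qop N OK (fun _ => True) γ', mem_truncCocycles.2 ⟨?_, hqg, fun σ hσ => ?_⟩, ?_⟩
  · rw [map_sub, hQ, Qop_Qop hd, sub_zero]
  · rw [hq, proj_apply, hγ σ hσ, ite_self]
  · have he : ψ - Qop N OK (fun _ => True) γ' - ψ = Qop N OK (fun _ => True) (-γ') := by
      rw [map_neg]
      abel
    rw [he]
    exact Qop_mem_cobounds hd (he ▸ Submodule.sub_mem _ hqg hg)

lemma exists_truncCocycle_proj_sub_mem_B21 (hd : DownClosed OK) (hex : Concentrated N ℓ OK)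
    {f : ℕ} {κ : AState N OK} (h : κ ∈ K21 N OK ℓ f) :
    ∃ χ ∈ truncCocycles N ℓ OK f,
      proj N OK (fun σ => countOn (S1 N ℓ) σ = ℓ) χ - κ ∈ B21 N OK ℓ f := by
  obtain ⟨⟨hQ, hg⟩, φ, hφ⟩ := h
  rw [SetLike.mem_coe, LinearMap.mem_ker] at hQ
  set p : Config N → Prop := fun σ => countOn (S1 N ℓ) σ = ℓ with hp
  set κ' := proj N OK p κ with hκ'
  set φ' := proj N OK (fun σ => countOn (S1 N ℓ) σ + 1 = ℓ) φ with hφ'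
  have hκ1 : Qop N OK (S1 N ℓ) κ' = 0 := by
    have hp := proj_Qop_S1 (ℓ := ℓ) hd (fun n => n = ℓ + 1) κ
    simp only [Nat.add_right_cancel_iff] at hp
    rw [hκ', ← hp, hQ, map_zero]
  have hφ1 : Qop N OK (S1 N ℓ) φ' = Qop N OK (S2 N ℓ) κ' := by
    rw [hφ', hκ', ← proj_Qop_S1 (ℓ := ℓ) hd (fun n => n = ℓ),
      ← proj_Qop_S2 (ℓ := ℓ) hd (fun n => n = ℓ), hφ]
  have hφs : ∀ σ, ℓ ≤ countOn (S1 N ℓ) σ.1 → φ' σ = 0 := by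
    intro σ hσ
    rw [hφ', proj_apply, if_neg (by omega)]
  have hQκ : Qop N OK (fun _ => True) (κ' - φ') = - Qop N OK (S2 N ℓ) φ' := by
    rw [map_sub, Qop_True_eq (ℓ := ℓ) hd, Qop_True_eq (ℓ := ℓ) hd φ', hκ1, hφ1]
    abel
  obtain ⟨η, hηs, hη⟩ := exists_Qop_eq_of_supported (ψ := Qop N OK (fun _ => True) (κ' - φ'))
    hd hex le_rfl
    (fun σ hσ => by rw [hQκ, Pi.neg_apply, Qop_S2_eq_zero hd hφs σ hσ, neg_zero])
    (Qop_Qop hd _ _)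
  refine ⟨proj N OK (fun σ => fermions σ = f) (κ' - φ' - η), mem_truncCocycles.2
    ⟨?_, proj_fermions_mem f _, fun σ hσ => ?_⟩, ?_⟩
  · have := proj_Qop_fermions hd (fun _ => True) (f + 1) (κ' - φ' - η)
    simp only [Nat.add_right_cancel_iff] at this
    rw [← this, map_sub, hη, sub_self, map_zero]
  · rw [proj_apply, Pi.sub_apply, Pi.sub_apply, hηs σ (by omega), hφs σ (by omega), hκ',
      proj_apply, if_neg (show ¬ p σ.1 by rw [hp]; simp only; omega)]
    simp
  · have he : proj N OK p (proj N OK (fun σ => fermions σ = f) (κ' - φ' - η)) = κ' := by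
      funext σ
      rw [proj_apply, proj_apply]
      by_cases hpσ : p σ.1
      · rw [if_pos hpσ, Pi.sub_apply, Pi.sub_apply, hηs σ (show countOn _ _ = ℓ from hpσ).ge,
          hφs σ (show countOn _ _ = ℓ from hpσ).ge, sub_zero, sub_zero]
        split_ifs with hf
        · rfl
        · exact (proj_mem_gradeV p hg σ hf).symm
      · rw [if_neg hpσ, hκ', proj_apply, if_neg hpσ]
    rw [he]
    refine ⟨Submodule.mem_sup_right ?_, Submodule.sub_mem _ (proj_mem_gradeV p hg) hg⟩
    refine hex _ (by rw [map_sub, hκ1, hQ, sub_zero]) fun σ hσ => ?_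
    rw [Pi.sub_apply, hκ', proj_apply, if_pos hσ, sub_self]

lemma mem_cobounds_iff_proj_mem_B21 (hd : DownClosed OK) (hex : Concentrated N ℓ OK)
    {f : ℕ} {ψ : AState N OK} (h : ψ ∈ truncCocycles N ℓ OK f) :
    ψ ∈ cobounds N OK (fun _ => True) f ↔
      proj N OK (fun σ => countOn (S1 N ℓ) σ = ℓ) ψ ∈ B21 N OK ℓ f := by
  obtain ⟨hQ, hg, hs⟩ := mem_truncCocycles.1 h
  constructor
  · rintro ⟨β, -, rfl⟩
    obtain ⟨γ, hγ⟩ := exists_sub_Qop_supported hd hex (ψ := β) hs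
    have hQβ : Qop N OK (fun _ => True) β =
        Qop N OK (fun _ => True) (β - Qop N OK (fun _ => True) γ) := by
      rw [map_sub, Qop_Qop hd, sub_zero]
    set β' := β - Qop N OK (fun _ => True) γ
    rw [hQβ] at hs hg ⊢
    refine ⟨?_, proj_mem_gradeV _ hg⟩
    rw [Qop_True_eq (ℓ := ℓ) hd, map_add, proj_Qop_S1 (ℓ := ℓ) hd (fun n => n = ℓ),
      proj_Qop_S2 (ℓ := ℓ) hd (fun n => n = ℓ), add_comm]
    refine Submodule.add_mem_sup ⟨_, ?_, rfl⟩ ⟨_, rfl⟩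
    rw [SetLike.mem_coe, LinearMap.mem_ker]
    have hp := proj_Qop_S1 (ℓ := ℓ) hd (fun n => n = ℓ + 1) β'
    simp only [Nat.add_right_cancel_iff] at hp
    rw [← hp]
    refine proj_eq_zero fun σ hσ => ?_
    have h3 := hs σ hσ.ge
    rwa [Qop_True_eq (ℓ := ℓ) hd, Pi.add_apply, Qop_S2_eq_zero hd hγ σ hσ.ge, add_zero] at h3
  · rintro ⟨hB, -⟩
    obtain ⟨_, ⟨α, hα, rfl⟩, _, ⟨β, rfl⟩, hαβ⟩ := Submodule.mem_sup.1 hB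
    rw [SetLike.mem_coe, LinearMap.mem_ker] at hα
    set α' := proj N OK (fun σ => countOn (S1 N ℓ) σ = ℓ) α with hα'
    set β' := proj N OK (fun σ => countOn (S1 N ℓ) σ + 1 = ℓ) β with hβ'
    have hα1 : Qop N OK (S1 N ℓ) α' = 0 := by
      have hp := proj_Qop_S1 (ℓ := ℓ) hd (fun n => n = ℓ + 1) α
      simp only [Nat.add_right_cancel_iff] at hp
      rw [hα', ← hp, hα, map_zero]
    have hsum : proj N OK (fun σ => countOn (S1 N ℓ) σ = ℓ) ψ =
        Qop N OK (S2 N ℓ) α' + Qop N OK (S1 N ℓ) β' := by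
      rw [hα', hβ', ← proj_Qop_S1 (ℓ := ℓ) hd (fun n => n = ℓ),
        ← proj_Qop_S2 (ℓ := ℓ) hd (fun n => n = ℓ), ← map_add, hαβ]
      refine (proj_eq_self fun σ hσ => ?_).symm
      rw [proj_apply, if_neg hσ]
    have he : ψ - Qop N OK (fun _ => True) (α' + β') =
        ψ - proj N OK (fun σ => countOn (S1 N ℓ) σ = ℓ) ψ - Qop N OK (S2 N ℓ) β' := by
      rw [hsum, map_add, Qop_True_eq (ℓ := ℓ) hd, Qop_True_eq (ℓ := ℓ) hd β', hα1]
      abel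
    obtain ⟨η, -, hη⟩ := exists_Qop_eq_of_supported
      (ψ := ψ - Qop N OK (fun _ => True) (α' + β')) hd hex le_rfl
      (fun σ hσ => by
        rw [he, Pi.sub_apply, Pi.sub_apply, Qop_S2_eq_zero (k := ℓ) hd _ σ hσ, proj_apply]
        · split_ifs with h1
          · simp
          · rw [hs σ (by omega)]
            simp
        · intro τ hτ
          rw [hβ', proj_apply, if_neg (by omega)])
      (by rw [map_sub, hQ, Qop_Qop hd, sub_zero])
    have hψ : ψ = Qop N OK (fun _ => True) (η + (α' + β')) := by
      rw [map_add, hη]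
      abel
    rw [hψ] at hg ⊢
    exact Qop_mem_cobounds hd hg

/-- If the cohomology of the first supercharge is concentrated in a single degree, the
cohomology of the full supercharge agrees with the two-step cohomology. -/
theorem nonempty_cohSpace_equiv_H21 (hd : DownClosed OK) (hex : Concentrated N ℓ OK) (f : ℕ) :
    Nonempty (CohSpace N OK (fun _ => True) f ≃ₗ[ℂ] H21 N OK ℓ f) := by
  let a : truncCocycles N ℓ OK f →ₗ[ℂ] CohSpace N OK (fun _ => True) f :=
    (Submodule.mkQ _).comp (Submodule.inclusion inf_le_left)
  let b : truncCocycles N ℓ OK f →ₗ[ℂ] H21 N OK ℓ f :=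
    (Submodule.mkQ _).comp
      (((proj N OK fun σ => countOn (S1 N ℓ) σ = ℓ).comp (Submodule.subtype _)).codRestrict
        (K21 N OK ℓ f) fun ψ => proj_mem_K21 hd ψ.2)
  have ha : Function.Surjective a := by
    intro c
    obtain ⟨⟨ψ, hψ⟩, rfl⟩ := Submodule.mkQ_surjective _ c
    obtain ⟨χ, hχ, h⟩ := exists_truncCocycle_sub_mem_cobounds hd hex hψ
    exact ⟨⟨χ, hχ⟩, (Submodule.Quotient.eq _).2 h⟩
  have hb : Function.Surjective b := by
    intro c
    obtain ⟨⟨κ, hκ⟩, rfl⟩ := Submodule.mkQ_surjective _ c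
    obtain ⟨χ, hχ, h⟩ := exists_truncCocycle_proj_sub_mem_B21 hd hex hκ
    exact ⟨⟨χ, hχ⟩, (Submodule.Quotient.eq _).2 h⟩
  have hk : LinearMap.ker a = LinearMap.ker b := by
    ext ⟨ψ, hψ⟩
    rw [LinearMap.mem_ker, LinearMap.mem_ker]
    exact (Submodule.Quotient.mk_eq_zero _).trans
      ((mem_cobounds_iff_proj_mem_B21 hd hex hψ).trans
        (Submodule.Quotient.mk_eq_zero (p := (B21 N OK ℓ f).comap (K21 N OK ℓ f).subtype)
          (x := ⟨_, proj_mem_K21 hd hψ⟩)).symm)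
  exact ⟨(a.quotKerEquivOfSurjective ha).symm ≪≫ₗ Submodule.quotEquivOfEq _ _ hk ≪≫ₗ
    b.quotKerEquivOfSurjective hb⟩

end TwoStep

section Boundary

variable {N ℓ : ℕ} {OK : Config N → Prop}

/-- For a fixed configuration on the second sublattice, the allowed configurations on the
first one are those of an open chain with special boundary conditions. -/
def EffectivelyOpen (N ℓ : ℕ) (OK : Config N → Prop) : Prop :=
  ∀ σ₀, OK σ₀ → ∃ a ≤ ℓ, ∃ b ≤ ℓ, ∀ σ : Config N, (∀ i, S2 N ℓ i → σ i = σ₀ i) →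
    (OK σ ↔ (∃ i : Fin N, i.1 ≤ a ∧ σ i = false) ∧
      ∃ i : Fin N, ℓ + 1 ≤ i.1 + b ∧ i.1 ≤ ℓ + 1 ∧ σ i = false)

/-- The restriction of a configuration to the second sublattice. -/
def background (N ℓ : ℕ) (σ : Config N) : Config N :=
  fun i => if i.1 < ℓ + 2 then false else σ i

lemma background_update {σ : Config N} {i : Fin N} (hi : S1 N ℓ i) (b : Bool) :
    background N ℓ (Function.update σ i b) = background N ℓ σ := by
  funext k
  unfold background
  split_ifs with hk
  · rfl
  · rw [Function.update_of_ne]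
    rintro rfl
    exact hk hi

lemma eq_of_background_eq {σ τ : Config N} (h : background N ℓ σ = background N ℓ τ)
    (i : Fin N) (hi : S2 N ℓ i) : σ i = τ i := by
  have := congrFun h i
  simpa [background, not_lt.2 (show ℓ + 2 ≤ i.1 from hi)] using this

lemma countOn_S1_eq (hN : ℓ + 2 ≤ N) {σ : Config N}
    (h : ∀ i : Fin N, i.1 < ℓ + 2 → (σ i = true ↔ 1 ≤ i.1 ∧ i.1 ≤ ℓ)) :
    countOn (S1 N ℓ) σ = ℓ := by
  have : (Finset.univ.filter fun i : Fin N => S1 N ℓ i ∧ σ i = true).map Fin.valEmbedding =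
      Finset.Icc 1 ℓ := by
    ext k
    simp only [Finset.mem_map, Finset.mem_filter, Finset.mem_univ, true_and,
      Fin.valEmbedding_apply, Finset.mem_Icc]
    constructor
    · rintro ⟨i, ⟨hi, hσ⟩, rfl⟩
      exact (h i hi).1 hσ
    · intro hk
      have hi : (⟨k, by omega⟩ : Fin N).1 < ℓ + 2 := by
        simp only
        omega
      exact ⟨⟨k, by omega⟩, ⟨hi, (h _ hi).2 hk⟩, rfl⟩
  unfold countOn
  rw [← Finset.card_map Fin.valEmbedding, this]
  simp

lemma concentrated_of_effectivelyOpen (hd : DownClosed OK) (hN : ℓ + 2 ≤ N)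
    (ho : EffectivelyOpen N ℓ OK) : Concentrated N ℓ OK := by
  intro ψ hψ hs
  let y : Fin N := ⟨0, by omega⟩
  let x : Fin N := ⟨ℓ + 1, by omega⟩
  have hx : S1 N ℓ x := show ℓ + 1 < ℓ + 2 by omega
  have hy : S1 N ℓ y := show 0 < ℓ + 2 by omega
  have hsame : ∀ (σ : Config N) (z : Fin N), S1 N ℓ z → ∀ c, ∀ i, S2 N ℓ i →
      Function.update σ z c i = σ i := fun σ z hz c =>
    eq_of_background_eq (background_update hz c)
  have hxy : ∀ σ, OK (Function.update σ x true) → OK (Function.update σ y true) →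
      OK (Function.update (Function.update σ y true) x true) := by
    intro σ h1 h2
    obtain ⟨a, ha, b, hb, h⟩ := ho _ h1
    have e1 := (h _ fun i _ => rfl).1 h1
    have e2 := (h _ fun i hi => by rw [hsame _ _ hy _ i hi, hsame _ _ hx _ i hi]).1 h2
    refine (h _ fun i hi => by
      rw [hsame _ _ hx _ i hi, hsame _ _ hy _ i hi, hsame _ _ hx _ i hi]).2 ⟨?_, ?_⟩
    · obtain ⟨⟨i, hi, hσ⟩, -⟩ := e2
      refine ⟨i, hi, ?_⟩
      rwa [Function.update_of_ne]
      rintro rfl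
      simp only [x] at hi
      omega
    · obtain ⟨-, ⟨i, hi, hi2, hσ⟩⟩ := e1
      refine ⟨i, hi, hi2, ?_⟩
      have hne : i ≠ y := by
        rintro rfl
        simp only [y] at hi
        omega
      rwa [Function.update_comm (by simp [x, y]), Function.update_of_ne hne]
  suffices h : ∀ β : Config N,
      proj N OK (fun σ => background N ℓ σ = β) ψ ∈ LinearMap.range (Qop N OK (S1 N ℓ)) by
    have hsum : ψ = ∑ β, proj N OK (fun σ => background N ℓ σ = β) ψ := by
      funext σ
      rw [Finset.sum_apply, Finset.sum_eq_single (background N ℓ σ.1)]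
      · simp [proj_apply]
      · intro β _ hβ
        rw [proj_apply, if_neg hβ.symm]
      · simp
    have hmem := Submodule.sum_mem (LinearMap.range (Qop N OK (S1 N ℓ)))
      (t := Finset.univ) fun β _ => h β
    rw [← hsum] at hmem
    exact hmem
  intro β
  have hcomm : ∀ χ, proj N OK (fun σ => background N ℓ σ = β) (Qop N OK (S1 N ℓ) χ) =
      Qop N OK (S1 N ℓ) (proj N OK (fun σ => background N ℓ σ = β) χ) := fun χ =>
    proj_Qop hd (fun τ i hi _ => by rw [background_update hi]) χ
  by_cases hβ : ∃ σ₀, OK σ₀ ∧ background N ℓ σ₀ = β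
  swap
  · rw [proj_eq_zero fun σ hσ => absurd ⟨σ.1, σ.2, hσ⟩ hβ]
    exact Submodule.zero_mem _
  obtain ⟨σ₀, hσ₀, rfl⟩ := hβ
  obtain ⟨a, ha, b, hb, h⟩ := ho σ₀ hσ₀
  have h' : ∀ σ : Config N, background N ℓ σ = background N ℓ σ₀ → _ := fun σ hσ =>
    h σ (eq_of_background_eq hσ)
  by_cases hab : a + b < ℓ
  · let z : Fin N := ⟨a + 1, by omega⟩
    have hz : S1 N ℓ z := show a + 1 < ℓ + 2 by omega
    refine ⟨proj N OK (fun σ => background N ℓ σ = background N ℓ σ₀) (removal OK z ψ), ?_⟩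
    rw [← hcomm, eq_comm, ← sub_eq_zero, ← map_sub]
    refine proj_eq_zero fun σ hσ => sub_Qop_removal_eq_zero hd hz hψ σ ?_
    obtain ⟨⟨i, hi, hσi⟩, ⟨j, hj, hj2, hσj⟩⟩ := (h' σ.1 hσ).1 σ.2
    refine (h' _ ((background_update hz _).trans hσ)).2 ⟨⟨i, hi, ?_⟩, ⟨j, hj, hj2, ?_⟩⟩
    · rwa [Function.update_of_ne]
      rintro rfl
      simp only [z] at hi
      omega
    · rwa [Function.update_of_ne]
      rintro rfl
      simp only [z] at hj
      omega
  · obtain ⟨φ, hφ⟩ := exists_sub_Qop_eq_zero hd hx hy hxy hψ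
    refine ⟨proj N OK (fun σ => background N ℓ σ = background N ℓ σ₀ ∧
      countOn (S1 N ℓ) σ + 1 ≠ ℓ) φ, ?_⟩
    have hc2 : proj N OK (fun σ => background N ℓ σ = background N ℓ σ₀ ∧
        countOn (S1 N ℓ) σ ≠ ℓ) (Qop N OK (S1 N ℓ) φ) = _ :=
      proj_Qop (p := fun σ => background N ℓ σ = background N ℓ σ₀ ∧
        countOn (S1 N ℓ) σ + 1 ≠ ℓ) hd (fun τ i hi hτ => by
          rw [background_update hi, countOn_update_of_mem hi hτ]) φ
    have hψ2 : proj N OK (fun σ => background N ℓ σ = background N ℓ σ₀) ψ =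
        proj N OK (fun σ => background N ℓ σ = background N ℓ σ₀ ∧
          countOn (S1 N ℓ) σ ≠ ℓ) ψ := by
      funext σ
      rw [proj_apply, proj_apply]
      by_cases hc : countOn (S1 N ℓ) σ.1 = ℓ
      · simp [hs σ hc]
      · simp [hc]
    rw [← hc2, hψ2, eq_comm, ← sub_eq_zero, ← map_sub]
    refine proj_eq_zero fun σ hσ => hφ σ ?_
    by_contra! hno
    obtain ⟨hnx, hny⟩ := hno
    obtain ⟨hbg, hcount⟩ := hσ
    have hupd : ∀ z : Fin N, ¬ OK (Function.update σ.1 z true) → σ.1 z = false := by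
      intro z hz
      by_contra hne
      rw [Bool.not_eq_false] at hne
      rw [← hne, Function.update_eq_self] at hz
      exact hz σ.2
    rw [h' _ ((background_update hx _).trans hbg)] at hnx
    rw [h' _ ((background_update hy _).trans hbg)] at hny
    have hσx := hupd x (by rwa [h' _ ((background_update hx _).trans hbg)])
    have hσy := hupd y (by rwa [h' _ ((background_update hy _).trans hbg)])
    obtain ⟨⟨i, hi, hσi⟩, ⟨j, hj, hj2, hσj⟩⟩ := (h' σ.1 hbg).1 σ.2
    have hA : ∀ k : Fin N, k.1 ≤ a → k ≠ y → σ.1 k = true := by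
      intro k hk hky
      by_contra hne
      rw [Bool.not_eq_true] at hne
      refine hny ⟨⟨k, hk, by rwa [Function.update_of_ne hky]⟩, ⟨j, hj, hj2, ?_⟩⟩
      rwa [Function.update_of_ne]
      rintro rfl
      simp only [y] at hj
      omega
    have hB : ∀ k : Fin N, ℓ + 1 ≤ k.1 + b → k.1 ≤ ℓ + 1 → k ≠ x → σ.1 k = true := by
      intro k hk hk2 hkx
      by_contra hne
      rw [Bool.not_eq_true] at hne
      refine hnx ⟨⟨i, hi, ?_⟩, ⟨k, hk, hk2, by rwa [Function.update_of_ne hkx]⟩⟩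
      rwa [Function.update_of_ne]
      rintro rfl
      simp only [x] at hi
      omega
    refine hcount (countOn_S1_eq hN fun k hk => ?_)
    by_cases hky : k = y
    · subst hky
      simp [hσy, y]
    by_cases hkx : k = x
    · subst hkx
      simp [hσx, x]
    have hk0 : k.1 ≠ 0 := fun h0 => hky (Fin.ext h0)
    have hk1 : k.1 ≠ ℓ + 1 := fun h0 => hkx (Fin.ext h0)
    have : σ.1 k = true := by
      by_cases hka : k.1 ≤ a
      · exact hA k hka hky
      · exact hB k (by omega) (by omega) hkx
    simp only [this, true_iff]
    omega

lemma eq_false_of_update_false {σ : Config N} {i j : Fin N} (h : σ j = false) :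
    Function.update σ i false j = false := by
  by_cases hij : j = i
  · subst hij
    simp
  · rwa [Function.update_of_ne hij]

lemma downClosed_PerOK : DownClosed (PerOK N ℓ) := by
  intro σ i h j
  obtain ⟨k, hk, hσ⟩ := h j
  exact ⟨k, hk, eq_false_of_update_false hσ⟩

lemma extc_of_lt {σ : Config N} {t : ℕ} (h : t < N) : extc σ t = σ ⟨t, h⟩ := by
  simp [extc, h]

lemma extc_of_le {σ : Config N} {t : ℕ} (h : N ≤ t) : extc σ t = false := by
  simp [extc, not_lt.2 h]

lemma extc_eq_true_of_update {σ : Config N} {i : Fin N} {t : ℕ}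
    (h : extc (Function.update σ i false) t = true) : extc σ t = true := by
  by_cases ht : t < N
  · rw [extc_of_lt ht] at h ⊢
    by_contra hne
    rw [Bool.not_eq_true] at hne
    rw [eq_false_of_update_false hne] at h
    exact absurd h (by simp)
  · rw [extc_of_le (not_lt.1 ht)] at h
    exact absurd h (by simp)

lemma downClosed_OpenOK (c₁ cN : ℕ) : DownClosed (OpenOK N ℓ c₁ cN) := by
  rintro σ i ⟨h1, h2, h3⟩
  exact ⟨fun a h => h1 a fun k hk => extc_eq_true_of_update (h k hk),
    fun h => h2 ⟨h.1, fun k hk => extc_eq_true_of_update (h.2 k hk)⟩,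
    fun h => h3 ⟨h.1, fun k hk => extc_eq_true_of_update (h.2 k hk)⟩⟩

lemma effectivelyOpen_OpenOK {c₁ cN : ℕ} (hN : 2 * ℓ + 3 ≤ N) (h₁ : c₁ ≤ ℓ) (hc : cN ≤ ℓ) :
    EffectivelyOpen N ℓ (OpenOK N ℓ c₁ cN) := by
  rintro σ₀ ⟨hw, -, hr⟩
  have hex : ∃ m, extc σ₀ (ℓ + 2 + m) = false := by
    by_contra! hne
    exact hw (ℓ + 2) fun k _ => by simpa using hne k
  obtain ⟨m, hm, hmin⟩ : ∃ m, extc σ₀ (ℓ + 2 + m) = false ∧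
      ∀ k < m, extc σ₀ (ℓ + 2 + k) = true :=
    ⟨Nat.find hex, Nat.find_spec hex, fun k hk => by simpa using Nat.find_min hex hk⟩
  have hmℓ : m ≤ ℓ := by
    by_contra hlt
    exact hw (ℓ + 2) fun k hk => hmin k (by omega)
  refine ⟨c₁, h₁, ℓ - m, by omega, fun σ hσ => ?_⟩
  have hext : ∀ t, ℓ + 2 ≤ t → extc σ t = extc σ₀ t := by
    intro t ht
    by_cases htN : t < N
    · rw [extc_of_lt htN, extc_of_lt htN, hσ ⟨t, htN⟩ ht]
    · rw [extc_of_le (not_lt.1 htN), extc_of_le (not_lt.1 htN)]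
  constructor
  · rintro ⟨h1, h2, -⟩
    constructor
    · by_contra! hne
      refine h2 ⟨by omega, fun k hk => ?_⟩
      rw [extc_of_lt (by omega)]
      simpa using hne ⟨k, by omega⟩ hk
    · by_contra! hne
      refine h1 (m + 1) fun k hk => ?_
      by_cases hlt : m + 1 + k < ℓ + 2
      · rw [extc_of_lt (by omega)]
        simpa using hne ⟨m + 1 + k, by omega⟩ (by simp only; omega) (by simp only; omega)
      · rw [hext _ (by omega), show m + 1 + k = ℓ + 2 + (m + 1 + k - (ℓ + 2)) by omega]
        exact hmin _ (by omega)
  · rintro ⟨⟨i, hi, hσi⟩, ⟨j, hj, hj2, hσj⟩⟩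
    refine ⟨fun s hs => ?_, fun hs => ?_, fun hs => ?_⟩
    · have hval : ∀ t, s ≤ t → t ≤ s + ℓ → extc σ t = true := by
        intro t h1 h2
        have := hs (t - s) (by omega)
        rwa [show s + (t - s) = t by omega] at this
      have hfalse : ∀ i : Fin N, σ i = false → s ≤ i.1 → i.1 ≤ s + ℓ → False := by
        intro i hi h1 h2
        have := hval i.1 h1 h2
        rw [extc_of_lt i.2, hi] at this
        exact absurd this (by simp)
      by_cases hs0 : s = 0
      · exact hfalse i hσi (by omega) (by omega)
      by_cases hs2 : ℓ + 2 ≤ s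
      · exact hw s fun k hk => by rw [← hext _ (by omega), hs k hk]
      by_cases hsm : s ≤ m + 1
      · exact hfalse j hσj (by omega) (by omega)
      · have := hval (ℓ + 2 + m) (by omega) (by omega)
        rw [hext _ (by omega), hm] at this
        exact absurd this (by simp)
    · have := hs.2 i.1 hi
      rw [extc_of_lt i.2, hσi] at this
      exact absurd this (by simp)
    · exact hr ⟨hs.1, fun k hk => by rw [← hext _ (by omega), hs.2 k hk]⟩

lemma PerOK_iff (hN : ℓ < N) {σ : Config N} : PerOK N ℓ σ ↔
    ∀ s < N, ∃ i : Fin N, σ i = false ∧ ((s ≤ i.1 ∧ i.1 ≤ s + ℓ) ∨ i.1 + N ≤ s + ℓ) := by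
  constructor
  · intro h s hs
    obtain ⟨k, hk, hσ⟩ := h ⟨s, hs⟩
    refine ⟨_, hσ, ?_⟩
    simp only [cyc]
    by_cases hlt : s + k < N
    · rw [Nat.mod_eq_of_lt hlt]
      omega
    · rw [Nat.mod_eq_sub_mod (not_lt.1 hlt), Nat.mod_eq_of_lt (by omega)]
      omega
  · intro h s
    have hs := s.2
    obtain ⟨i, hσ, hi | hi⟩ := h s.1 s.2
    · refine ⟨i.1 - s.1, by omega, ?_⟩
      rw [← hσ]
      congr 1
      apply Fin.ext
      simp only [cyc]
      rw [show s.1 + (i.1 - s.1) = i.1 by omega, Nat.mod_eq_of_lt i.2]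
    · refine ⟨i.1 + N - s.1, by omega, ?_⟩
      rw [← hσ]
      congr 1
      apply Fin.ext
      simp only [cyc]
      rw [show s.1 + (i.1 + N - s.1) = i.1 + N by omega, Nat.add_mod_right,
        Nat.mod_eq_of_lt i.2]

lemma effectivelyOpen_PerOK (hN : 2 * ℓ + 3 ≤ N) : EffectivelyOpen N ℓ (PerOK N ℓ) := by
  intro σ₀ h₀
  rw [PerOK_iff (by omega)] at h₀
  obtain ⟨m, hmℓ, hm, hmin⟩ : ∃ m ≤ ℓ, (∀ i : Fin N, i.1 = ℓ + 2 + m → σ₀ i = false) ∧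
      ∀ i : Fin N, ℓ + 2 ≤ i.1 → i.1 < ℓ + 2 + m → σ₀ i = true := by
    obtain ⟨i, hσ, hi⟩ := h₀ (ℓ + 2) (by omega)
    have hex : ∃ m, ∃ i : Fin N, i.1 = ℓ + 2 + m ∧ σ₀ i = false :=
      ⟨i.1 - (ℓ + 2), i, by omega, hσ⟩
    refine ⟨Nat.find hex, (Nat.find_min' hex ⟨i, by omega, hσ⟩).trans
      (show i.1 - (ℓ + 2) ≤ ℓ by omega), fun k hk => ?_, fun k h1 h2 => ?_⟩
    · obtain ⟨i', hi', hσ'⟩ := Nat.find_spec hex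
      rwa [Fin.ext (hk.trans hi'.symm)]
    · by_contra hne
      rw [Bool.not_eq_true] at hne
      exact Nat.find_min hex (m := k.1 - (ℓ + 2)) (by omega) ⟨k, by omega, hne⟩
  obtain ⟨n, hnℓ, hn, hnin⟩ : ∃ n ≤ ℓ, (∀ i : Fin N, i.1 + 1 + n = N → σ₀ i = false) ∧
      ∀ i : Fin N, N < i.1 + 1 + n → σ₀ i = true := by
    obtain ⟨i, hσ, hi⟩ := h₀ (N - 1 - ℓ) (by omega)
    have hiN := i.2
    have hex : ∃ n, ∃ i : Fin N, i.1 + 1 + n = N ∧ σ₀ i = false :=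
      ⟨N - 1 - i.1, i, by omega, hσ⟩
    refine ⟨Nat.find hex, (Nat.find_min' hex ⟨i, by omega, hσ⟩).trans
      (show N - 1 - i.1 ≤ ℓ by omega), fun k hk => ?_, fun k h1 => ?_⟩
    · obtain ⟨i', hi', hσ'⟩ := Nat.find_spec hex
      rwa [Fin.ext (show k.1 = i'.1 by omega)]
    · by_contra hne
      rw [Bool.not_eq_true] at hne
      have hkN := k.2
      exact Nat.find_min hex (m := N - 1 - k.1) (by omega) ⟨k, by omega, hne⟩
  refine ⟨ℓ - n, by omega, ℓ - m, by omega, fun σ hσ => ?_⟩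
  have hS2 : ∀ i : Fin N, ℓ + 2 ≤ i.1 → σ i = σ₀ i := hσ
  rw [PerOK_iff (by omega)]
  constructor
  · intro h
    constructor
    · by_cases hn0 : n = 0
      · obtain ⟨i, hi, hi2⟩ := h 0 (by omega)
        exact ⟨i, by omega, hi⟩
      · obtain ⟨i, hi, hi2⟩ := h (N - n) (by omega)
        refine ⟨i, ?_, hi⟩
        by_contra hlt
        rw [hS2 i (by omega), hnin i (by omega)] at hi
        exact absurd hi (by simp)
    · obtain ⟨i, hi, hi2⟩ := h (m + 1) (by omega)
      refine ⟨i, by omega, ?_, hi⟩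
      by_contra hlt
      rw [hS2 i (by omega), hmin i (by omega) (by omega)] at hi
      exact absurd hi (by simp)
  · rintro ⟨⟨i, hi, hσi⟩, ⟨j, hj, hj2, hσj⟩⟩ s hs
    by_cases hs0 : s = 0
    · exact ⟨i, hσi, by omega⟩
    by_cases hsm : s ≤ m + 1
    · exact ⟨j, hσj, by omega⟩
    by_cases hsl : s ≤ ℓ + 1
    · refine ⟨⟨ℓ + 2 + m, by omega⟩, ?_, by simp only; omega⟩
      rw [hS2 _ (by simp only; omega), hm _ rfl]
    by_cases hsn : N ≤ s + n
    · exact ⟨i, hσi, by omega⟩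
    obtain ⟨k, hk, hk2⟩ := h₀ s hs
    by_cases hsk : s ≤ k.1
    · exact ⟨k, by rw [hS2 _ (by omega), hk], by omega⟩
    · refine ⟨⟨N - 1 - n, by omega⟩, ?_, by simp only; omega⟩
      rw [hS2 _ (by simp only; omega), hn _ (by simp only; omega)]

end Boundary

/-- Tic-tac-toe for the `M_ℓ` chain: for `N = Ñ + (ℓ+2) > 2ℓ+2` sites with periodic
or special boundary conditions, the cohomology `H_Q^f` of the full supercharge
`Q = Q₁ + Q₂` is isomorphic to the graded piece `H₂₁^f` of the two-step cohomology,
for every `f`; in particular their dimensions agree. -/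
theorem HQ_iso_H21 (ℓ Nt : ℕ) (hℓ : 1 ≤ ℓ) (hNt : ℓ < Nt)
    (OKN : Config (Nt + (ℓ + 2)) → Prop)
    (hBC : OKN = PerOK (Nt + (ℓ + 2)) ℓ ∨
      ∃ c₁ cN, c₁ ≤ ℓ ∧ cN ≤ ℓ ∧ OKN = OpenOK (Nt + (ℓ + 2)) ℓ c₁ cN) :
    ∀ f, Nonempty (CohSpace (Nt + (ℓ + 2)) OKN (fun _ => True) f ≃ₗ[ℂ]
        H21 (Nt + (ℓ + 2)) OKN ℓ f) ∧
      cohDim (Nt + (ℓ + 2)) OKN (fun _ => True) f =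
        Module.finrank ℂ (H21 (Nt + (ℓ + 2)) OKN ℓ f) := by
  intro f
  have hd : DownClosed OKN := by
    rcases hBC with rfl | ⟨c₁, cN, -, -, rfl⟩
    · exact downClosed_PerOK
    · exact downClosed_OpenOK c₁ cN
  have ho : EffectivelyOpen (Nt + (ℓ + 2)) ℓ OKN := by
    rcases hBC with rfl | ⟨c₁, cN, h₁, hc, rfl⟩
    · exact effectivelyOpen_PerOK (by omega)
    · exact effectivelyOpen_OpenOK (by omega) h₁ hc
  obtain ⟨e⟩ := nonempty_cohSpace_equiv_H21 hd
    (concentrated_of_effectivelyOpen hd (by omega) ho) f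
  exact ⟨⟨e⟩, e.finrank_eq⟩

end
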